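/- Let k, m, n be integers with 1 ≤ m ≤ n − m. Then L_{k,m,n} is a root lattice (i.e. the form is positive definite and L_{k,m,n} is generated as an additive group by its elements of squared norm 2) if and only if k = 2 and one of the following holds: (1) m = 1 and n ≥ 2; (2) m = 2 and n ≥ 4; (3) m = 3 and 6 ≤ n ≤ 8. -/

import Mathlib

open Finset

/-- The latitude of a vector `x ∈ ℚⁿ`: the sum of its coordinates. -/
noncomputable def lat {n : ℕ} (x : Fin n → ℚ) : ℚ := ∑ i, x i

/-- The symmetric bilinear form `(x|y)_{k,m,n} = x·y + (k-m)·lat(x)·lat(y)/m²` on `ℚⁿ`. -/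
noncomputable def form (k m : ℤ) {n : ℕ} (x y : Fin n → ℚ) : ℚ :=
  (∑ i, x i * y i) + (k - m) * lat x * lat y / (m : ℚ) ^ 2

/-- The lattice `L_{k,m,n} = {x ∈ ℤⁿ : m ∣ lat(x)}` (as a subset of `ℚⁿ`). -/
def latt (m : ℤ) (n : ℕ) : Set (Fin n → ℚ) :=
  {x | (∀ i, ∃ a : ℤ, x i = a) ∧ ∃ t : ℤ, lat x = m * t}

lemma lat_sub {n : ℕ} (x y : Fin n → ℚ) : lat (x - y) = lat x - lat y := by
  simp [lat]

lemma lat_add {n : ℕ} (x y : Fin n → ℚ) : lat (x + y) = lat x + lat y := by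
  simp [lat, Finset.sum_add_distrib]

lemma lat_neg {n : ℕ} (x : Fin n → ℚ) : lat (-x) = -lat x := by
  simp [lat]

lemma lat_single {n : ℕ} (i : Fin n) (c : ℚ) : lat (Pi.single i c) = c := by
  simp [lat]

lemma lat_comp_perm {n : ℕ} (x : Fin n → ℚ) (σ : Equiv.Perm (Fin n)) :
    lat (x ∘ σ) = lat x :=
  Equiv.sum_comp σ x

lemma form_sub_self (k m : ℤ) {n : ℕ} (x y : Fin n → ℚ) :
    form k m (x - y) (x - y) = form k m x x - 2 * form k m x y + form k m y y := by
  have h : ∑ i, (x - y) i * (x - y) i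
      = ∑ i, x i * x i - 2 * ∑ i, x i * y i + ∑ i, y i * y i := by
    rw [Finset.mul_sum, ← Finset.sum_sub_distrib, ← Finset.sum_add_distrib]
    exact Finset.sum_congr rfl fun i _ => by simp only [Pi.sub_apply]; ring
  simp only [form, lat_sub, h]
  ring

lemma form_neg_neg (k m : ℤ) {n : ℕ} (x y : Fin n → ℚ) :
    form k m (-x) (-y) = form k m x y := by
  simp [form, lat_neg]

lemma form_comp_perm (k m : ℤ) {n : ℕ} (x y : Fin n → ℚ) (σ : Equiv.Perm (Fin n)) :
    form k m (x ∘ σ) (y ∘ σ) = form k m x y := by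
  simp only [form, lat_comp_perm]
  congr 1
  exact Equiv.sum_comp σ fun i => x i * y i

/-- On vectors of latitudes `m * s` and `m * t` the form is the Euclidean product shifted
by `(k - m) * s * t`. -/
lemma form_eq_of_lat {k m : ℤ} (hm : m ≠ 0) {n : ℕ} {x y : Fin n → ℚ} {s t : ℚ}
    (hx : lat x = m * s) (hy : lat y = m * t) :
    form k m x y = ∑ i, x i * y i + (k - m) * s * t := by
  have : (m : ℚ) ≠ 0 := by exact_mod_cast hm
  rw [form, hx, hy]
  field_simp

/-- Positive definiteness, evaluated at the all-ones vector. -/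
lemma mul_sub_lt_sq_of_posDef {k m : ℤ} {n : ℕ} (hm : m ≠ 0) (hn : 0 < n)
    (hpos : ∀ x : Fin n → ℚ, x ≠ 0 → 0 < form k m x x) :
    (n : ℤ) * (m - k) < m ^ 2 := by
  have hne : (fun _ : Fin n => (1 : ℚ)) ≠ 0 := fun h => by
    simpa using congrFun h ⟨0, hn⟩
  have h := hpos _ hne
  have hm2 : (0 : ℚ) < (m : ℚ) ^ 2 := by positivity
  have hn' : (0 : ℚ) < n := by exact_mod_cast hn
  have hform : form k m (fun _ : Fin n => (1 : ℚ)) (fun _ => 1)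
      = n * (m ^ 2 - n * (m - k)) / m ^ 2 := by
    simp only [form, lat, mul_one, Finset.sum_const, Finset.card_univ, Fintype.card_fin,
      nsmul_eq_mul]
    field_simp
    ring
  rw [hform, div_pos_iff_of_pos_right hm2, mul_pos_iff_of_pos_left hn'] at h
  have : (n : ℚ) * (m - k) < m ^ 2 := by linarith
  exact_mod_cast this

lemma posDef_of_mul_sub_lt_sq {k m : ℤ} {n : ℕ} (hm : m ≠ 0)
    (h : (n : ℤ) * (m - k) < m ^ 2) (x : Fin n → ℚ) (hx : x ≠ 0) :
    0 < form k m x x := by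
  have hm2 : (0 : ℚ) < (m : ℚ) ^ 2 := by positivity
  have hsq : 0 < ∑ i, x i * x i := by
    obtain ⟨i, hi⟩ := Function.ne_iff.mp hx
    exact Finset.sum_pos' (fun i _ => mul_self_nonneg _)
      ⟨i, Finset.mem_univ i, mul_self_pos.mpr hi⟩
  have hcs : lat x ^ 2 ≤ n * ∑ i, x i * x i := by
    simpa [lat, sq] using sq_sum_le_card_mul_sum_sq (s := Finset.univ) (f := x)
  have h' : (n : ℚ) * (m - k) < m ^ 2 := by exact_mod_cast h
  have hform : form k m x x
      = (m ^ 2 * (∑ i, x i * x i) - (m - k) * lat x ^ 2) / m ^ 2 := by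
    simp only [form]
    field_simp
    ring
  rw [hform]
  refine div_pos ?_ hm2
  rcases le_total ((m : ℚ) - k) 0 with hd | hd
  · nlinarith [mul_nonneg (neg_nonneg.mpr hd) (sq_nonneg (lat x)), mul_pos hm2 hsq]
  · nlinarith [mul_le_mul_of_nonneg_left hcs hd, mul_pos (sub_pos.mpr h') hsq]

lemma latt_sub_mem {m : ℤ} {n : ℕ} {x y : Fin n → ℚ} (hx : x ∈ latt m n)
    (hy : y ∈ latt m n) : x - y ∈ latt m n := by
  obtain ⟨hx, s, hs⟩ := hx
  obtain ⟨hy, t, ht⟩ := hy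
  refine ⟨fun i => ?_, s - t, by rw [lat_sub, hs, ht]; push_cast; ring⟩
  obtain ⟨a, ha⟩ := hx i
  obtain ⟨b, hb⟩ := hy i
  exact ⟨a - b, by simp [ha, hb]⟩

lemma latt_neg_mem {m : ℤ} {n : ℕ} {x : Fin n → ℚ} (hx : x ∈ latt m n) :
    -x ∈ latt m n := by
  obtain ⟨hx, s, hs⟩ := hx
  refine ⟨fun i => ?_, -s, by rw [lat_neg, hs]; push_cast; ring⟩
  obtain ⟨a, ha⟩ := hx i
  exact ⟨-a, by simp [ha]⟩

lemma latt_comp_perm_mem {m : ℤ} {n : ℕ} {x : Fin n → ℚ} (hx : x ∈ latt m n)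
    (σ : Equiv.Perm (Fin n)) : x ∘ σ ∈ latt m n := by
  obtain ⟨hx, s, hs⟩ := hx
  exact ⟨fun i => hx (σ i), s, by rw [lat_comp_perm, hs]⟩

/-- `L_{k,m,n}` has a vector of squared norm `2` and latitude `m * t`. -/
def HasRootAt (k m : ℤ) (n : ℕ) (t : ℤ) : Prop :=
  ∃ x ∈ latt m n, form k m x x = 2 ∧ lat x = m * t

lemma HasRootAt.neg {k m : ℤ} {n : ℕ} {t : ℤ} (h : HasRootAt k m n t) :
    HasRootAt k m n (-t) := by
  obtain ⟨x, hx, hx2, hxt⟩ := h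
  exact ⟨-x, latt_neg_mem hx, by rw [form_neg_neg, hx2], by rw [lat_neg, hxt]; simp⟩

/-- Sorting the coordinates of two roots makes their inner product positive, so that their
difference is again a root. -/
lemma HasRootAt.sub {k m : ℤ} {n : ℕ} (hm : m ≠ 0) (hn : 0 < n)
    (hpos : ∀ x : Fin n → ℚ, x ≠ 0 → 0 < form k m x x) {s t : ℤ} (hs : 0 < s) (hst : s < t)
    (hrs : HasRootAt k m n s) (hrt : HasRootAt k m n t) : HasRootAt k m n (t - s) := by
  obtain ⟨y, hy, hy2, hys⟩ := hrs
  obtain ⟨x, hx, hx2, hxt⟩ := hrt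
  set x' := x ∘ Tuple.sort x
  set y' := y ∘ Tuple.sort y
  have hx' : x' ∈ latt m n := latt_comp_perm_mem hx _
  have hy' : y' ∈ latt m n := latt_comp_perm_mem hy _
  have hx2' : form k m x' x' = 2 := by rw [form_comp_perm, hx2]
  have hy2' : form k m y' y' = 2 := by rw [form_comp_perm, hy2]
  have hxt' : lat x' = m * t := by rw [lat_comp_perm, hxt]
  have hys' : lat y' = m * s := by rw [lat_comp_perm, hys]
  have hlat : lat (x' - y') = m * (t - s : ℤ) := by
    rw [lat_sub, hxt', hys']; push_cast; ring
  refine ⟨x' - y', latt_sub_mem hx' hy', ?_, hlat⟩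
  have hform := form_eq_of_lat (k := k) hm hxt' hys'
  obtain ⟨z, hz⟩ : ∃ z : ℤ, form k m x' y' = z := by
    choose a ha using hx'.1
    choose b hb using hy'.1
    exact ⟨∑ i, a i * b i + (k - m) * t * s, by rw [hform]; simp [ha, hb]⟩
  have hcheb : lat x' * lat y' ≤ n * ∑ i, x' i * y' i := by
    simpa [lat, x', y'] using
      ((Tuple.monotone_sort x).monovary (Tuple.monotone_sort y)).sum_mul_sum_le_card_mul_sum
  have hz0 : 0 < z := by
    have hn' : (0 : ℚ) < n := by exact_mod_cast hn
    have hdet : (n : ℚ) * (m - k) < m ^ 2 := by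
      exact_mod_cast mul_sub_lt_sq_of_posDef hm hn hpos
    have hts : (0 : ℚ) < t * s := by exact_mod_cast mul_pos (hs.trans hst) hs
    rw [hxt', hys'] at hcheb
    have : 0 < (n : ℚ) * form k m x' y' := by
      rw [hform]
      nlinarith [mul_pos (sub_pos.mpr hdet) hts]
    rw [hz] at this
    exact_mod_cast pos_of_mul_pos_right this hn'.le
  have hne : x' - y' ≠ 0 := by
    intro h
    rw [h] at hlat
    have : (m : ℚ) * (t - s : ℤ) = 0 := by rw [← hlat]; simp [lat]
    have : m * (t - s) = 0 := by exact_mod_cast this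
    rcases mul_eq_zero.mp this with h | h
    · exact hm h
    · omega
  have hpos' := hpos _ hne
  rw [form_sub_self, hx2', hy2', hz] at hpos' ⊢
  have hz2 : z < 2 := by
    have : (z : ℚ) < 2 := by linarith
    exact_mod_cast this
  obtain rfl : z = 1 := by omega
  norm_num

/-- If the lattice is generated by its roots, then any common divisor of their normalized
latitudes is a unit. -/
lemma isUnit_of_forall_hasRootAt_dvd {k m : ℤ} {n : ℕ} (hm : m ≠ 0) (hn : 0 < n)
    (hgen : ∀ x ∈ latt m n,
      x ∈ AddSubgroup.closure {y : Fin n → ℚ | y ∈ latt m n ∧ form k m y y = 2})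
    {g : ℤ} (hg : ∀ t, HasRootAt k m n t → g ∣ t) : IsUnit g := by
  have key : ∀ x ∈ AddSubgroup.closure {y : Fin n → ℚ | y ∈ latt m n ∧ form k m y y = 2},
      ∃ s : ℤ, lat x = m * (g * s : ℤ) := by
    intro x hx
    induction hx using AddSubgroup.closure_induction with
    | mem x hx =>
      obtain ⟨⟨hx, t, ht⟩, hx2⟩ := hx
      obtain ⟨s, rfl⟩ := hg t ⟨x, ⟨hx, t, ht⟩, hx2, ht⟩
      exact ⟨s, ht⟩
    | zero => exact ⟨0, by simp [lat]⟩
    | add x y _ _ hx hy =>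
      obtain ⟨s, hs⟩ := hx
      obtain ⟨t, ht⟩ := hy
      exact ⟨s + t, by rw [lat_add, hs, ht]; push_cast; ring⟩
    | neg x _ hx =>
      obtain ⟨s, hs⟩ := hx
      exact ⟨-s, by rw [lat_neg, hs]; push_cast; ring⟩
  obtain ⟨s, hs⟩ := key (Pi.single ⟨0, hn⟩ (m : ℚ)) <| hgen _
    ⟨fun i => ⟨(Pi.single ⟨0, hn⟩ m : Fin n → ℤ) i, by
      by_cases h : i = ⟨0, hn⟩
      · subst h; simp
      · simp [h]⟩, 1, by simp [lat_single]⟩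
  rw [lat_single] at hs
  have hs' : m * 1 = m * (g * s) := by rw [mul_one]; exact_mod_cast hs
  exact IsUnit.of_mul_eq_one s (mul_left_cancel₀ hm hs').symm

lemma hasRootAt_one {k m : ℤ} {n : ℕ} (hm : m ≠ 0) (hn : 0 < n)
    (hpos : ∀ x : Fin n → ℚ, x ≠ 0 → 0 < form k m x x)
    (hgen : ∀ x ∈ latt m n,
      x ∈ AddSubgroup.closure {y : Fin n → ℚ | y ∈ latt m n ∧ form k m y y = 2}) :
    HasRootAt k m n 1 := by
  classical
  have hex : ∃ t : ℕ, 0 < t ∧ HasRootAt k m n t := by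
    by_contra! hno
    refine not_isUnit_zero (isUnit_of_forall_hasRootAt_dvd hm hn hgen (g := 0) ?_)
    intro t ht
    rw [zero_dvd_iff]
    by_contra h0
    refine hno t.natAbs (Int.natAbs_pos.mpr h0) ?_
    rcases Int.natAbs_eq t with h | h
    · rwa [← h]
    · rw [h] at ht
      simpa using ht.neg
  obtain ⟨hg0, hg⟩ := Nat.find_spec hex
  set g := Nat.find hex
  have hdvd : ∀ t : ℕ, HasRootAt k m n t → g ∣ t := by
    intro t
    induction t using Nat.strong_induction_on with
    | _ t ih =>
      intro ht
      rcases Nat.eq_zero_or_pos t with rfl | ht0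
      · exact dvd_zero g
      have hle : g ≤ t := Nat.find_min' hex ⟨ht0, ht⟩
      rcases hle.eq_or_lt with h | hlt
      · exact h ▸ dvd_rfl
      have hsub := HasRootAt.sub hm hn hpos (by exact_mod_cast hg0) (by exact_mod_cast hlt) hg ht
      rw [← Nat.cast_sub hle] at hsub
      exact (Nat.dvd_sub_iff_left hle dvd_rfl).mp (ih (t - g) (by omega) hsub)
  have hunit : IsUnit (g : ℤ) := by
    refine isUnit_of_forall_hasRootAt_dvd hm hn hgen fun t ht => ?_
    rw [Int.natCast_dvd]
    refine hdvd _ ?_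
    rcases Int.natAbs_eq t with h | h
    · rwa [← h]
    · rw [h] at ht
      simpa using ht.neg
  have h1 : g = 1 := by simpa [Int.isUnit_iff_natAbs_eq] using hunit
  rw [h1] at hg
  exact_mod_cast hg

lemma HasRootAt.le_two_and_even {k m : ℤ} {n : ℕ} (hm : m ≠ 0) (h : HasRootAt k m n 1) :
    k ≤ 2 ∧ Even k := by
  obtain ⟨x, hx, hx2, hx1⟩ := h
  choose a ha using hx.1
  rw [form_eq_of_lat hm hx1 hx1] at hx2
  simp only [lat, ha] at hx1 hx2
  have hsum : ∑ i, a i = m := by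
    have : ((∑ i, a i : ℤ) : ℚ) = m := by push_cast; simpa using hx1
    exact_mod_cast this
  have hnorm : ∑ i, a i * a i + (k - m) = 2 := by
    have : ((∑ i, a i * a i + (k - m) : ℤ) : ℚ) = 2 := by push_cast; simpa using hx2
    exact_mod_cast this
  have hle : ∑ i, a i ≤ ∑ i, a i * a i :=
    Finset.sum_le_sum fun i _ => by simpa [sq] using Int.le_self_sq (a i)
  have heven : Even (∑ i, a i * a i - ∑ i, a i) := by
    rw [← Finset.sum_sub_distrib]
    refine Finset.even_sum _ fun i _ => ?_
    rw [← mul_sub_one]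
    exact Int.even_mul_pred_self (a i)
  refine ⟨by omega, ?_⟩
  rw [Int.even_iff] at heven ⊢
  omega

/-- For `k = 2` the vectors `e_i - e_j`, together with the sum of `m` unit vectors,
generate the lattice. -/
lemma mem_closure_roots {m : ℤ} {n : ℕ} (hm : 0 < m) (hmn : m ≤ n) {x : Fin n → ℚ}
    (hx : x ∈ latt m n) :
    x ∈ AddSubgroup.closure {y : Fin n → ℚ | y ∈ latt m n ∧ form 2 m y y = 2} := by
  set R := {y : Fin n → ℚ | y ∈ latt m n ∧ form 2 m y y = 2}
  have hn : 0 < n := by omega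
  have hdiff : ∀ i j : Fin n,
      (Pi.single i 1 - Pi.single j 1 : Fin n → ℚ) ∈ AddSubgroup.closure R := by
    intro i j
    rcases eq_or_ne i j with rfl | hij
    · rw [sub_self]
      exact zero_mem _
    refine AddSubgroup.subset_closure ⟨⟨fun l => ?_, 0, ?_⟩, ?_⟩
    · exact ⟨(Pi.single i 1 - Pi.single j 1 : Fin n → ℤ) l, by
        simp only [Pi.sub_apply, Pi.single_apply]; push_cast; rfl⟩
    · simp [lat_sub, lat_single]
    · rw [form_sub_self]
      simp [form, lat_single, Pi.single_apply, hij.symm]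
      ring
  obtain ⟨S, -, hS⟩ := Finset.exists_subset_card_eq (s := (Finset.univ : Finset (Fin n)))
    (n := m.toNat) (by simp; omega)
  have hSm : (S.card : ℚ) = m := by
    have : (S.card : ℤ) = m := by omega
    exact_mod_cast this
  set u : Fin n → ℚ := fun i => if i ∈ S then 1 else 0
  have hu_lat : lat u = m := by simp [lat, u, hSm]
  have hu : u ∈ AddSubgroup.closure R := by
    refine AddSubgroup.subset_closure ⟨⟨fun i => ⟨if i ∈ S then 1 else 0, by
      simp only [u]; push_cast; rfl⟩, 1, by simp [hu_lat]⟩, ?_⟩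
    rw [form_eq_of_lat hm.ne' (s := 1) (t := 1) (by simp [hu_lat]) (by simp [hu_lat])]
    simp [u, hSm]
  obtain ⟨hxi, t, ht⟩ := hx
  choose a ha using hxi
  let z : Fin n → ℤ := fun i => a i - t * (if i ∈ S then 1 else 0)
  have hz : ∀ i, (z i : ℚ) = x i - t * u i := fun i => by simp [z, u, ha]
  have hz_sum : ∑ i, (z i : ℚ) = 0 := by
    simp only [hz, Finset.sum_sub_distrib, ← Finset.mul_sum]
    change lat x - t * lat u = 0
    rw [ht, hu_lat]
    ring
  have hdecomp : x = t • u + ∑ i, z i • (Pi.single i 1 - Pi.single ⟨0, hn⟩ 1 : Fin n → ℚ) := by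
    ext j
    have hj : (∑ i, z i • (Pi.single i 1 - Pi.single ⟨0, hn⟩ 1 : Fin n → ℚ)) j
        = z j - (∑ i, (z i : ℚ)) * (Pi.single ⟨0, hn⟩ 1 : Fin n → ℚ) j := by
      simp [Finset.sum_apply, mul_sub, Finset.sum_sub_distrib, Pi.single_apply]
    rw [Pi.add_apply, hj, hz_sum, hz]
    simp
  rw [hdecomp]
  exact add_mem (zsmul_mem hu t) (sum_mem fun i _ => zsmul_mem (hdiff _ _) _)

/-- For `1 ≤ m ≤ n - m`, the lattice `L_{k,m,n}` is a root lattice (positive definite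
and generated by its vectors of squared norm `2`) if and only if `k = 2` and either
`m = 1, n ≥ 2`, or `m = 2, n ≥ 4`, or `m = 3, 6 ≤ n ≤ 8`. -/
theorem stmt16 (k m : ℤ) (n : ℕ) (h1 : 1 ≤ m) (h2 : m ≤ (n : ℤ) - m) :
    ((∀ x : Fin n → ℚ, x ≠ 0 → 0 < form k m x x) ∧
      ∀ x ∈ latt m n,
        x ∈ AddSubgroup.closure {y : Fin n → ℚ | y ∈ latt m n ∧ form k m y y = 2}) ↔
    (k = 2 ∧ ((m = 1 ∧ 2 ≤ n) ∨ (m = 2 ∧ 4 ≤ n) ∨ (m = 3 ∧ 6 ≤ n ∧ n ≤ 8))) := by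
  have hm : m ≠ 0 := by omega
  have hn : 0 < n := by omega
  constructor
  · rintro ⟨hpos, hgen⟩
    obtain ⟨hk2, hk⟩ := (hasRootAt_one hm hn hpos hgen).le_two_and_even hm
    have hdet := mul_sub_lt_sq_of_posDef hm hn hpos
    have hk0 : 0 < k := by
      by_contra! h
      nlinarith
    obtain rfl : k = 2 := by
      rw [Int.even_iff] at hk
      omega
    have hm3 : m ≤ 3 := by
      by_contra! h
      nlinarith
    refine ⟨rfl, ?_⟩
    interval_cases m <;> omega
  · rintro ⟨rfl, h⟩
    refine ⟨posDef_of_mul_sub_lt_sq hm ?_, fun x hx => mem_closure_roots (by omega) (by omega) hx⟩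
    rcases h with ⟨rfl, _⟩ | ⟨rfl, _⟩ | ⟨rfl, _, _⟩ <;> omega
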